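/- arXiv:2204.13488 — 4 statements merged into one kernel-verified Lean document; each statement's English description precedes it below -/
import Mathlib

section
/- Fix θ and ω > 0. Suppose p* ∈ K satisfies g(p*, θ) = 0, p̂ ∈ K satisfies ℓ_n(p̂) − ω·‖g(p̂, θ)‖₂² ≥ ℓ_n(p*) − ω·‖g(p*, θ)‖₂², and there exist constants r > 0 and C > 0 such that for all p₁, p₂ ∈ K with max(‖g(p₁, θ)‖₂, ‖g(p₂, θ)‖₂) ≤ r one has ‖p₁ − p₂‖₂ ≤ C·‖g(p₁, θ) − g(p₂, θ)‖₂. If moreover −ℓ_n(p*) ≤ ω·r², then ‖p̂ − p*‖₂ ≤ C·√(−ℓ_n(p*)/ω). -/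
/-- Under the local inverse Lipschitz condition, the inner-loop
optimizer `p̂` satisfies `‖p̂ - p*‖₂ ≤ C·√(-ℓ_n(p*)/ω)`. -/
theorem stmt1 {d₁ : ℕ} {Θ : Type*} {n : ℕ}
    (K : Set (EuclideanSpace ℝ (Fin d₁))) (hK : IsCompact K)
    (Ψ : EuclideanSpace ℝ (Fin d₁) → Θ → EuclideanSpace ℝ (Fin d₁))
    (g : EuclideanSpace ℝ (Fin d₁) → Θ → EuclideanSpace ℝ (Fin d₁))
    (hg : ∀ p θ, g p θ = Ψ p θ - p)
    (f : ℝ → EuclideanSpace ℝ (Fin d₁) → ℝ)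
    (hf : ∀ y p, f y p ≤ 0)
    (Y : Fin n → ℝ)
    (ℓ : EuclideanSpace ℝ (Fin d₁) → ℝ)
    (hℓ : ∀ p, ℓ p = (1 / (n : ℝ)) * ∑ i, f (Y i) p)
    (θ : Θ) (ω : ℝ) (hω : 0 < ω)
    (pstar phat : EuclideanSpace ℝ (Fin d₁))
    (hpstarK : pstar ∈ K) (hphatK : phat ∈ K)
    (hstar : g pstar θ = 0)
    (hopt : ℓ phat - ω * ‖g phat θ‖ ^ 2 ≥ ℓ pstar - ω * ‖g pstar θ‖ ^ 2)
    (r C : ℝ) (hr : 0 < r) (hC : 0 < C)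
    (hLip : ∀ p₁ ∈ K, ∀ p₂ ∈ K, max ‖g p₁ θ‖ ‖g p₂ θ‖ ≤ r →
      ‖p₁ - p₂‖ ≤ C * ‖g p₁ θ - g p₂ θ‖)
    (hsmall : -ℓ pstar ≤ ω * r ^ 2) :
    ‖phat - pstar‖ ≤ C * Real.sqrt (-ℓ pstar / ω) := by
  have h0 : ℓ phat ≤ 0 := by
    rw [hℓ]
    exact mul_nonpos_of_nonneg_of_nonpos (by positivity)
      (Finset.sum_nonpos fun i _ => hf _ _)
  have h1 : ω * ‖g phat θ‖ ^ 2 ≤ -ℓ pstar := by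
    rw [hstar, norm_zero] at hopt
    linarith
  have h2 : ‖g phat θ‖ ≤ Real.sqrt (-ℓ pstar / ω) := by
    apply Real.le_sqrt_of_sq_le
    rw [le_div_iff₀ hω]
    linarith
  have h3 : ‖g phat θ‖ ≤ r := by
    have h4 : ‖g phat θ‖ ^ 2 ≤ r ^ 2 := le_of_mul_le_mul_left (h1.trans hsmall) hω
    nlinarith [norm_nonneg (g phat θ)]
  have h5 := hLip phat hphatK pstar hpstarK (by
    rw [hstar, norm_zero]
    exact max_le h3 hr.le)
  rw [hstar, sub_zero] at h5
  exact h5.trans (mul_le_mul_of_nonneg_left h2 hC.le)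
end

section
/- Let Θ be a nonempty set, L : ℝ^{d₁} → ℝ a function, p̂, p* : Θ → ℝ^{d₁} maps such that θ ↦ L(p̂(θ)) and θ ↦ L(p*(θ)) are bounded on Θ, ω > 0, and J : Θ → ℝ with J(θ) ≥ 0 for all θ. Suppose the inner-loop optimality inequality L(p̂(θ)) − ω·J(θ) ≥ L(p*(θ)) holds for every θ ∈ Θ, and θ̃ ∈ Θ satisfies L(p̂(θ̃)) − ω·J(θ̃) ≥ L(p̂(θ)) − ω·J(θ) for all θ ∈ Θ (θ̃ maximizes the penalized criterion). Then L(p*(θ̃)) ≥ sup_{θ ∈ Θ} L(p*(θ)) − sup_{θ ∈ Θ} |L(p̂(θ)) − L(p*(θ))|. -/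
/-- If `θ̃` maximizes the penalized criterion and the inner-loop
inequality `L(p̂(θ)) - ω·J(θ) ≥ L(p*(θ))` holds for all `θ`, then
`L(p*(θ̃)) ≥ sup_θ L(p*(θ)) - sup_θ |L(p̂(θ)) - L(p*(θ))|`. -/
theorem stmt6 {d₁ : ℕ} (Θ : Type*) [Nonempty Θ]
    (L : EuclideanSpace ℝ (Fin d₁) → ℝ)
    (phat pstar : Θ → EuclideanSpace ℝ (Fin d₁))
    (hb1 : ∃ M : ℝ, ∀ θ, |L (phat θ)| ≤ M)
    (hb2 : ∃ M : ℝ, ∀ θ, |L (pstar θ)| ≤ M)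
    (ω : ℝ) (hω : 0 < ω)
    (J : Θ → ℝ) (hJ : ∀ θ, 0 ≤ J θ)
    (hinner : ∀ θ, L (phat θ) - ω * J θ ≥ L (pstar θ))
    (θtilde : Θ)
    (hmax : ∀ θ, L (phat θ) - ω * J θ ≤ L (phat θtilde) - ω * J θtilde) :
    (⨆ θ, L (pstar θ)) - (⨆ θ, |L (phat θ) - L (pstar θ)|) ≤ L (pstar θtilde) := by
  obtain ⟨M, hM⟩ := hb1
  obtain ⟨N, hN⟩ := hb2
  have hbdd : BddAbove (Set.range fun θ => |L (phat θ) - L (pstar θ)|) := by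
    refine ⟨M + N, ?_⟩
    rintro _ ⟨θ, rfl⟩
    exact (abs_sub _ _).trans (add_le_add (hM θ) (hN θ))
  have h1 : |L (phat θtilde) - L (pstar θtilde)| ≤ ⨆ θ, |L (phat θ) - L (pstar θ)| :=
    le_ciSup hbdd θtilde
  have h2 : (⨆ θ, L (pstar θ)) ≤ L (phat θtilde) := by
    refine ciSup_le fun θ => ?_
    have := mul_nonneg hω.le (hJ θtilde)
    linarith [hinner θ, hmax θ]
  linarith [le_abs_self (L (phat θtilde) - L (pstar θtilde))]
end

section
/- Let a, b, c, s, t be real numbers with s ≠ 0 and t ≠ 0. Then, as ω → ∞, the function F(ω) = (a − 2ω·s²) − (c + 2ω·s²/t)² / (b − 2ω·(s/t)²) tends to the limit a + b·t² + 2·c·t. -/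
/-- The Schur-complement limit: as `ω → ∞`,
`(a - 2ωs²) - (c + 2ωs²/t)² / (b - 2ω(s/t)²) → a + b·t² + 2·c·t`. -/
theorem stmt9 (a b c s t : ℝ) (hs : s ≠ 0) (ht : t ≠ 0) :
    Filter.Tendsto
      (fun ω : ℝ => (a - 2 * ω * s ^ 2) - (c + 2 * ω * s ^ 2 / t) ^ 2 / (b - 2 * ω * (s / t) ^ 2))
      Filter.atTop (nhds (a + b * t ^ 2 + 2 * c * t)) := by
  have hk : 0 < 2 * (s / t) ^ 2 := by positivity
  have hD : Filter.Tendsto (fun ω : ℝ => b - 2 * ω * (s / t) ^ 2) Filter.atTop Filter.atBot := by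
    have h1 : Filter.Tendsto (fun ω : ℝ => b + -(2 * (s / t) ^ 2 * ω)) Filter.atTop Filter.atBot :=
      Filter.tendsto_atBot_add_const_left _ b
        (Filter.tendsto_neg_atTop_atBot.comp (Filter.tendsto_id.const_mul_atTop hk))
    refine h1.congr fun ω => by ring
  have h2 := (hD.inv_tendsto_atBot.const_mul ((c + t * b) ^ 2)).const_sub
    (a + b * t ^ 2 + 2 * c * t)
  rw [mul_zero, sub_zero] at h2
  refine h2.congr' ?_
  filter_upwards [hD.eventually (Filter.eventually_lt_atBot 0)] with ω hω
  have e1 : 2 * ω * s ^ 2 = t ^ 2 * (b - (b - 2 * ω * (s / t) ^ 2)) := by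
    field_simp
    ring
  have e2 : 2 * ω * s ^ 2 / t = t * (b - (b - 2 * ω * (s / t) ^ 2)) := by
    field_simp
    ring
  rw [e2, e1, Pi.inv_apply]
  generalize b - 2 * ω * (s / t) ^ 2 = D at hω
  have hD0 : D ≠ 0 := hω.ne
  field_simp
  ring
end

section
/- Let ℓ, g : ℝ × ℝ → ℝ be twice continuously differentiable and β̂ : ℝ → ℝ twice differentiable with g(β̂(θ), θ) = 0 for all θ. Fix θ̂ and write all partial derivatives ℓ_β, ℓ_{ββ}, ℓ_{βθ}, ℓ_{θθ}, g_β, g_θ, g_{ββ}, g_{βθ}, g_{θθ} evaluated at the point (β̂(θ̂), θ̂). Assume g_β ≠ 0 and let λ ∈ ℝ satisfy ℓ_β + λ·g_β = 0 (the Lagrange first-order condition). Then the second derivative of the profiled likelihood θ ↦ ℓ(β̂(θ), θ) at θ̂ equals (g_θ/g_β)²·(ℓ_{ββ} + λ·g_{ββ}) − 2·(g_θ/g_β)·(ℓ_{βθ} + λ·g_{βθ}) + (ℓ_{θθ} + λ·g_{θθ}). -/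
/-- First and second derivatives of `θ ↦ f (β θ) θ` in terms of partial derivatives. -/
theorem chain_aux (f : ℝ → ℝ → ℝ) (hf : ContDiff ℝ 2 (Function.uncurry f))
    (β : ℝ → ℝ) (hβ : Differentiable ℝ β) (hβ' : Differentiable ℝ (deriv β)) (θ : ℝ) :
    deriv (fun θ => f (β θ) θ) θ =
      deriv β θ * deriv (fun b => f b θ) (β θ) + deriv (fun t => f (β θ) t) θ ∧
    deriv (deriv (fun θ => f (β θ) θ)) θ =
      deriv β θ ^ 2 * deriv (fun b => deriv (fun b' => f b' θ) b) (β θ)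
      + 2 * deriv β θ * deriv (fun t => deriv (fun b => f b t) (β θ)) θ
      + deriv (fun t => deriv (fun t' => f (β θ) t') t) θ
      + deriv (deriv β) θ * deriv (fun b => f b θ) (β θ) := by
  have hF : ∀ p, HasFDerivAt (Function.uncurry f) (fderiv ℝ (Function.uncurry f) p) p :=
    fun p => (hf.differentiable (by norm_num) p).hasFDerivAt
  have hsymm := (hf.contDiffAt (x := (β θ, θ))).isSymmSndFDerivAt (by simp)
  have hD1 : ContDiff ℝ 1 (fderiv ℝ (Function.uncurry f)) :=
    hf.fderiv_right (by norm_num)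
  have hD : ∀ p, HasFDerivAt (fderiv ℝ (Function.uncurry f))
      (fderiv ℝ (fderiv ℝ (Function.uncurry f)) p) p :=
    fun p => (hD1.differentiable (by norm_num) p).hasFDerivAt
  unfold IsSymmSndFDerivAt at hsymm
  have hs := hsymm (1, 0) (0, 1)
  clear hsymm hD1
  generalize fderiv ℝ (fderiv ℝ (Function.uncurry f)) = D2 at *
  generalize fderiv ℝ (Function.uncurry f) = D at *
  have c1 : ∀ b t : ℝ, HasDerivAt (fun b : ℝ => (b, t)) ((1 : ℝ), (0 : ℝ)) b :=
    fun b t => (hasDerivAt_id b).prodMk (hasDerivAt_const b t)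
  have c2 : ∀ b t : ℝ, HasDerivAt (fun t : ℝ => (b, t)) ((0 : ℝ), (1 : ℝ)) t :=
    fun b t => (hasDerivAt_const t b).prodMk (hasDerivAt_id t)
  have c3 : ∀ t : ℝ, HasDerivAt (fun t : ℝ => (β t, t)) (deriv β t, (1 : ℝ)) t :=
    fun t => (hβ t).hasDerivAt.prodMk (hasDerivAt_id t)
  have K1 : ∀ (c : ℝ → ℝ × ℝ) (c' : ℝ × ℝ) (t : ℝ), HasDerivAt c c' t →
      HasDerivAt (fun s => Function.uncurry f (c s)) (D (c t) c') t :=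
    fun c c' t h => HasFDerivAt.comp_hasDerivAt (f := c) t (hF (c t)) h
  have K2 : ∀ (c v : ℝ → ℝ × ℝ) (c' v' : ℝ × ℝ) (t : ℝ), HasDerivAt c c' t →
      HasDerivAt v v' t →
      HasDerivAt (fun s => D (c s) (v s)) (D2 (c t) c' (v t) + D (c t) v') t := by
    intro c v c' v' t h h'
    have h2 : HasDerivAt (fun s => D (c s)) (D2 (c t) c') t :=
      HasFDerivAt.comp_hasDerivAt (f := c) t (hD (c t)) h
    exact h2.clm_apply h'
  have p1 : ∀ b t : ℝ, deriv (fun b => f b t) b = D (b, t) (1, 0) :=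
    fun b t => (K1 (fun b => (b, t)) _ b (c1 b t)).deriv
  have p2 : ∀ b t : ℝ, deriv (fun t => f b t) t = D (b, t) (0, 1) :=
    fun b t => (K1 (fun t => (b, t)) _ t (c2 b t)).deriv
  have p3 : ∀ t : ℝ, deriv (fun t => f (β t) t) t = D (β t, t) (deriv β t, 1) :=
    fun t => (K1 (fun t => (β t, t)) _ t (c3 t)).deriv
  have q1 : ∀ b t : ℝ, deriv (fun b => D (b, t) (1, 0)) b = D2 (b, t) (1, 0) (1, 0) := by
    intro b t
    have := (K2 (fun b => (b, t)) (fun _ => (1, 0)) _ _ b (c1 b t) (hasDerivAt_const b _)).deriv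
    rw [this, map_zero, add_zero]
  have q2 : ∀ (v : ℝ × ℝ) (b t : ℝ), deriv (fun t => D (b, t) v) t = D2 (b, t) (0, 1) v := by
    intro v b t
    have := (K2 (fun t => (b, t)) (fun _ => v) _ _ t (c2 b t) (hasDerivAt_const t _)).deriv
    rw [this, map_zero, add_zero]
  have q3 : deriv (fun t => D (β t, t) (deriv β t, 1)) θ =
      D2 (β θ, θ) (deriv β θ, 1) (deriv β θ, 1) + D (β θ, θ) (deriv (deriv β) θ, 0) :=
    (K2 (fun t => (β t, t)) (fun t => (deriv β t, 1)) _ _ θ (c3 θ)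
      ((hβ' θ).hasDerivAt.prodMk (hasDerivAt_const θ (1 : ℝ)))).deriv
  have e1 : ∀ x : ℝ, ((x, 1) : ℝ × ℝ) = x • (1, 0) + (0, 1) := by intro x; simp
  have e2 : ∀ x : ℝ, ((x, 0) : ℝ × ℝ) = x • (1, 0) := by intro x; simp
  constructor
  · rw [p3, p1, p2, e1, map_add, map_smul, smul_eq_mul]
  · rw [funext p3, q3]
    simp only [p1, p2, q1, q2]
    rw [e1, e2 (deriv (deriv β) θ)]
    simp only [map_add, map_smul, smul_eq_mul, ContinuousLinearMap.add_apply,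
      ContinuousLinearMap.smul_apply]
    rw [hs]
    ring

/-- scalar Corollary 2: the second derivative of the profiled
likelihood `θ ↦ ℓ(β̂(θ), θ)` at `θ̂` equals
`(g_θ/g_β)²(ℓ_ββ + λg_ββ) - 2(g_θ/g_β)(ℓ_βθ + λg_βθ) + (ℓ_θθ + λg_θθ)`. -/
theorem stmt10 (ℓ g : ℝ → ℝ → ℝ)
    (hℓ : ContDiff ℝ 2 (Function.uncurry ℓ))
    (hg : ContDiff ℝ 2 (Function.uncurry g))
    (β : ℝ → ℝ) (hβ : Differentiable ℝ β) (hβ' : Differentiable ℝ (deriv β))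
    (hcon : ∀ θ, g (β θ) θ = 0)
    (θhat lam : ℝ)
    (hgβ : deriv (fun b => g b θhat) (β θhat) ≠ 0)
    (hlam : deriv (fun b => ℓ b θhat) (β θhat) + lam * deriv (fun b => g b θhat) (β θhat) = 0) :
    deriv (deriv (fun θ => ℓ (β θ) θ)) θhat =
      (deriv (fun t => g (β θhat) t) θhat / deriv (fun b => g b θhat) (β θhat)) ^ 2 *
          (deriv (fun b => deriv (fun b' => ℓ b' θhat) b) (β θhat)
            + lam * deriv (fun b => deriv (fun b' => g b' θhat) b) (β θhat))
        - 2 * (deriv (fun t => g (β θhat) t) θhat / deriv (fun b => g b θhat) (β θhat)) *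
          (deriv (fun t => deriv (fun b => ℓ b t) (β θhat)) θhat
            + lam * deriv (fun t => deriv (fun b => g b t) (β θhat)) θhat)
        + (deriv (fun t => deriv (fun t' => ℓ (β θhat) t') t) θhat
            + lam * deriv (fun t => deriv (fun t' => g (β θhat) t') t) θhat) := by
  obtain ⟨-, l2⟩ := chain_aux ℓ hℓ β hβ hβ' θhat
  obtain ⟨g1, g2⟩ := chain_aux g hg β hβ hβ' θhat
  have h0 : (fun θ => g (β θ) θ) = fun _ => 0 := funext hcon
  have h1 : deriv (fun _ : ℝ => (0 : ℝ)) = fun _ => 0 := by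
    funext x
    simp
  rw [h0, h1] at g1 g2
  rw [h1] at g2
  rw [l2]
  clear l2
  generalize deriv (fun b => g b θhat) (β θhat) = gb at *
  generalize deriv (fun b => ℓ b θhat) (β θhat) = lb at *
  have hq : deriv (fun t => g (β θhat) t) θhat / gb = - deriv β θhat := by
    rw [div_eq_iff hgβ]
    linarith
  rw [hq]
  linear_combination deriv (deriv β) θhat * hlam + lam * g2
end
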